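/- arXiv:2004.01421 — 4 statements merged into one kernel-verified Lean document; each statement's English description precedes it below -/
import Mathlib

section
/- Fix θ > 0, m > 0 and c > 0, and define f(P) = P + (c/m²)·(P·e^{−mθ/P} − P + mθ) for P > 0. Then the derivative P ↦ f′(P) = 1 − c/m² + (c/m²)·e^{−mθ/P}·(1 + mθ/P) is strictly increasing on (0, ∞), and hence f is strictly convex on (0, ∞). -/
open Real

theorem strictAntiOn_exp_neg_mul_one_add :
    StrictAntiOn (fun x : ℝ => exp (-x) * (1 + x)) (Set.Ici 0) := by
  intro x (hx : 0 ≤ x) y _ hxy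
  have hexp : y - x + 1 < exp (y - x) := add_one_lt_exp (sub_ne_zero.2 hxy.ne')
  have hlt : 1 + y < exp (y - x) * (1 + x) := by
    nlinarith [mul_nonneg hx (sub_pos.2 hxy).le]
  calc exp (-y) * (1 + y) < exp (-y) * (exp (y - x) * (1 + x)) := by gcongr
    _ = exp (-x) * (1 + x) := by
      rw [← mul_assoc, ← exp_add]
      ring_nf

theorem hasDerivAt_mul_exp_neg_div (a : ℝ) {P : ℝ} (hP : P ≠ 0) :
    HasDerivAt (fun P : ℝ => P * exp (-(a / P))) (exp (-(a / P)) * (1 + a / P)) P := by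
  have hdiv : HasDerivAt (fun P : ℝ => -(a / P)) (a / P ^ 2) P :=
    ((hasDerivAt_inv hP).const_mul (-a)).congr_deriv (by ring) |>.congr_of_eventuallyEq
      (.of_forall fun x => by simp only [div_eq_mul_inv, neg_mul])
  refine ((hasDerivAt_id P).mul hdiv.exp).congr_deriv ?_
  simp only [id]
  field_simp

/-- For `θ > 0`, `m > 0`, `c > 0`, the derivative
`P ↦ 1 − c/m² + (c/m²)·e^{−mθ/P}·(1 + mθ/P)` of
`f(P) = P + (c/m²)(P·e^{−mθ/P} − P + mθ)` is strictly increasing on `(0, ∞)`,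
and `f` is strictly convex on `(0, ∞)`. -/
theorem rtd_power_strictConvex (θ m c : ℝ) (hθ : 0 < θ) (hm : 0 < m) (hc : 0 < c) :
    StrictMonoOn
      (fun P : ℝ => 1 - c / m ^ 2 + (c / m ^ 2) * Real.exp (-(m * θ / P)) * (1 + m * θ / P))
      (Set.Ioi 0) ∧
    StrictConvexOn ℝ (Set.Ioi 0)
      (fun P : ℝ => P + (c / m ^ 2) * (P * Real.exp (-(m * θ / P)) - P + m * θ)) := by
  have hmono : StrictMonoOn
      (fun P : ℝ => 1 - c / m ^ 2 + (c / m ^ 2) * Real.exp (-(m * θ / P)) * (1 + m * θ / P))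
      (Set.Ioi 0) := by
    intro P (hP : 0 < P) Q (hQ : 0 < Q) hPQ
    have hdiv : m * θ / Q < m * θ / P := by gcongr
    have hlt := strictAntiOn_exp_neg_mul_one_add
      (show 0 ≤ m * θ / Q by positivity) (show 0 ≤ m * θ / P by positivity) hdiv
    simp only [mul_assoc (c / m ^ 2)]
    gcongr
  have hderiv : ∀ P ∈ Set.Ioi (0 : ℝ), HasDerivAt
      (fun P : ℝ => P + (c / m ^ 2) * (P * Real.exp (-(m * θ / P)) - P + m * θ))
      (1 - c / m ^ 2 + (c / m ^ 2) * Real.exp (-(m * θ / P)) * (1 + m * θ / P)) P := by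
    intro P (hP : 0 < P)
    exact ((hasDerivAt_id P).add ((((hasDerivAt_mul_exp_neg_div (m * θ) hP.ne').sub
      (hasDerivAt_id P)).add_const (m * θ)).const_mul (c / m ^ 2))).congr_deriv (by ring)
  refine ⟨hmono, StrictMonoOn.strictConvexOn_of_deriv (convex_Ioi 0)
    (fun P hP => (hderiv P hP).continuousAt.continuousWithinAt) ?_⟩
  rw [interior_Ioi]
  exact hmono.congr fun P hP => (hderiv P hP).deriv.symm
end

section
/- Fix θ > 0, m > 0, c > 0 with m² < c, and define f(P) = P + (c/m²)·(P·e^{−mθ/P} − P + mθ) for P > 0. Let t* be the unique t > 0 satisfying (1 + t)·e^{−t} = 1 − m²/c. Then P̂₁ := mθ/t* is the unique global minimizer of f on (0, ∞): f(P̂₁) < f(P) for every P > 0 with P ≠ P̂₁. -/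
open Real

/-- Theorem 1: For `θ > 0`, `m > 0`, `c > 0` with `m² < c`, if `t*` is the
unique `t > 0` satisfying `(1 + t)·e^{−t} = 1 − m²/c`, then `P̂₁ = mθ/t*` is the unique
global minimizer of `f(P) = P + (c/m²)(P·e^{−mθ/P} − P + mθ)` on `(0, ∞)`. -/
theorem rtd_optimal_power (θ m c : ℝ) (hθ : 0 < θ) (hm : 0 < m) (hc : 0 < c)
    (hmc : m ^ 2 < c)
    (tstar : ℝ) (htpos : 0 < tstar)
    (htstar : (1 + tstar) * Real.exp (-tstar) = 1 - m ^ 2 / c) :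
    ∀ P : ℝ, 0 < P → P ≠ m * θ / tstar →
      (fun P : ℝ => P + (c / m ^ 2) * (P * Real.exp (-(m * θ / P)) - P + m * θ))
          (m * θ / tstar)
        < (fun P : ℝ => P + (c / m ^ 2) * (P * Real.exp (-(m * θ / P)) - P + m * θ)) P := by
  intro P hP hne
  have ha : 0 < m * θ := mul_pos hm hθ
  have hk : 0 < c / m ^ 2 := by positivity
  have key (Q E : ℝ) : Q + c / m ^ 2 * (Q * E - Q + m * θ)
      = c / m ^ 2 * (Q * (E - (1 + tstar) * Real.exp (-tstar)) + m * θ) := by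
    rw [htstar]
    field_simp
    ring
  beta_reduce
  rw [key, key, div_div_cancel₀ ha.ne']
  refine mul_lt_mul_of_pos_left (add_lt_add_left ?_ _) hk
  have hts : tstar - m * θ / P ≠ 0 := by
    intro h
    apply hne
    rw [sub_eq_zero.mp h, div_div_cancel₀ ha.ne']
  have hexp : (tstar - m * θ / P + 1) * Real.exp (-tstar) < Real.exp (-(m * θ / P)) := by
    calc (tstar - m * θ / P + 1) * Real.exp (-tstar)
        < Real.exp (tstar - m * θ / P) * Real.exp (-tstar) :=
          mul_lt_mul_of_pos_right (Real.add_one_lt_exp hts) (Real.exp_pos _)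
      _ = Real.exp (-(m * θ / P)) := by
          rw [← Real.exp_add]
          congr 1
          ring
  calc m * θ / tstar * (Real.exp (-tstar) - (1 + tstar) * Real.exp (-tstar))
      = P * (-(m * θ / P) * Real.exp (-tstar)) := by
        field_simp
        ring
    _ < P * (Real.exp (-(m * θ / P)) - (1 + tstar) * Real.exp (-tstar)) :=
        mul_lt_mul_of_pos_left (by linarith) hP
end

section
/- Fix θ > 0, m > 0, c > 0 with m² < c, and define f(P) = P + (c/m²)·(P·e^{−mθ/P} − P + mθ) for P > 0. Let x* be the unique x ∈ (−∞, −1) satisfying x·e^{x} = m²/(c·e) − 1/e. Then x* + 1 < 0 and P̂₁ := −mθ/(x* + 1) is the unique global minimizer of f on (0, ∞). -/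
open Real

/-- The strict tangent-line inequality for `P ↦ P * exp (-(a / P))` on the positive reals. -/
lemma tangent_lt_mul_exp_neg_div {a P Q : ℝ} (ha : 0 < a) (hP : 0 < P) (hQ : 0 < Q)
    (hPQ : P ≠ Q) :
    Q * exp (-(a / Q)) + (1 + a / Q) * exp (-(a / Q)) * (P - Q) < P * exp (-(a / P)) := by
  have hne : a / Q - a / P ≠ 0 := fun h =>
    hPQ (mul_left_cancel₀ ha.ne' ((div_eq_div_iff hQ.ne' hP.ne').1 (sub_eq_zero.1 h)))
  have hexp : exp (-(a / P)) = exp (-(a / Q)) * exp (a / Q - a / P) := by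
    rw [← exp_add]
    ring_nf
  calc
    _ = P * exp (-(a / Q)) * (a / Q - a / P + 1) := by
      field_simp
      ring
    _ < P * exp (-(a / Q)) * exp (a / Q - a / P) := by
      gcongr
      exact add_one_lt_exp hne
    _ = _ := by rw [hexp, mul_assoc]

/-- Lambert-W form of Theorem 1: For `θ > 0`, `m > 0`, `c > 0` with
`m² < c`, if `x*` is the unique `x ∈ (−∞, −1)` with `x·e^x = m²/(ce) − 1/e`, then
`x* + 1 < 0` and `P̂₁ = −mθ/(x* + 1)` is the unique global minimizer of
`f(P) = P + (c/m²)(P·e^{−mθ/P} − P + mθ)` on `(0, ∞)`. -/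
theorem rtd_optimal_power_lambert (θ m c : ℝ) (hθ : 0 < θ) (hm : 0 < m) (hc : 0 < c)
    (hmc : m ^ 2 < c)
    (xstar : ℝ) (hxlt : xstar < -1)
    (hxeq : xstar * Real.exp xstar = m ^ 2 / (c * Real.exp 1) - 1 / Real.exp 1) :
    xstar + 1 < 0 ∧
    ∀ P : ℝ, 0 < P → P ≠ -(m * θ) / (xstar + 1) →
      (fun P : ℝ => P + (c / m ^ 2) * (P * Real.exp (-(m * θ / P)) - P + m * θ))
          (-(m * θ) / (xstar + 1))
        < (fun P : ℝ => P + (c / m ^ 2) * (P * Real.exp (-(m * θ / P)) - P + m * θ)) P := by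
  have hx : xstar + 1 < 0 := by linarith
  refine ⟨hx, fun P hP hne => ?_⟩
  beta_reduce
  have ha : 0 < m * θ := mul_pos hm hθ
  set Q := -(m * θ) / (xstar + 1) with hQdef
  have hQ : 0 < Q := div_pos_of_neg_of_neg (neg_neg_of_pos ha) hx
  have hu : m * θ / Q = -(xstar + 1) := by
    rw [hQdef]
    field_simp [hx.ne]
  have hcrit : (1 + m * θ / Q) * exp (-(m * θ / Q)) = 1 - m ^ 2 / c := by
    rw [hu, neg_neg, exp_add]
    have h : xstar * exp xstar * exp 1 = m ^ 2 / c - 1 := by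
      rw [hxeq]
      field_simp
    linear_combination -h
  have htan := tangent_lt_mul_exp_neg_div ha hP hQ hne
  rw [hcrit] at htan
  have hscaled := mul_lt_mul_of_pos_left htan (div_pos hc (pow_pos hm 2))
  have hcancel : c / m ^ 2 * (m ^ 2 / c) = 1 := by field_simp
  linear_combination hscaled + (P - Q) * hcancel
end

section
/- Let σ ∈ (0,1), T > 0, and set a = (1 − σ²)/σ². Then ∫₀^{T} e^{−x} [ (1 + a x) e^{−a x} − (1 + a x + a x (T − x)/σ²) e^{−a x − (T − x)/σ²} ] dx = −(e^{−T/σ²}/(6σ⁴)) · [ (6σ⁸ − 12σ⁶) e^{T/σ²} + 12σ⁶ + (3σ² − 3σ⁴) T² + (12σ⁴ − 6σ⁶) T + (1 − σ²) T³ − 6σ⁸ ]. -/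
open Real

theorem integral_one_add_mul_exp_sub (a b c T : ℝ) (hb : b ≠ 0) :
    ∫ x in (0:ℝ)..T,
        ((1 + a * x) * Real.exp (-(b * x)) - (1 + a * x + a * b * x * (T - x)) * c) =
      (1 / b + a / b ^ 2) - (1 / b + a / b ^ 2 + a / b * T) * Real.exp (-(b * T)) -
        (T + a * T ^ 2 / 2 + a * b * T ^ 3 / 6) * c := by
  have hderiv : ∀ x ∈ Set.uIcc 0 T, HasDerivAt
      (fun x : ℝ => -(1 / b + a / b ^ 2 + a / b * x) * Real.exp (-(b * x)) -
        (x + a * x ^ 2 / 2 + a * b * (T * x ^ 2 / 2 - x ^ 3 / 3)) * c)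
      ((1 + a * x) * Real.exp (-(b * x)) - (1 + a * x + a * b * x * (T - x)) * c) x := by
    intro x _
    have hx := hasDerivAt_id' x
    have hlin := ((hx.const_mul (a / b)).const_add (1 / b + a / b ^ 2)).neg
    have hexp := (hx.const_mul b).neg.exp
    have hcubic := ((((hx.pow 2).const_mul T).div_const 2).sub ((hx.pow 3).div_const 3)).const_mul
      (a * b)
    have hpoly := ((hx.add (((hx.pow 2).const_mul a).div_const 2)).add hcubic).mul_const c
    refine ((hlin.mul hexp).sub hpoly).congr_deriv ?_
    simp only [Pi.neg_apply]
    field_simp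
    ring
  rw [intervalIntegral.integral_eq_sub_of_hasDerivAt hderiv
    (Continuous.intervalIntegrable (by fun_prop) _ _)]
  simp only [mul_zero, neg_zero, Real.exp_zero]
  ring

/-- integral evaluation underlying Theorem 2: for `σ ∈ (0,1)`, `T > 0`
and `a = (1 − σ²)/σ²`,
`∫₀^T e^{−x}[(1+ax)e^{−ax} − (1+ax+ax(T−x)/σ²)e^{−ax−(T−x)/σ²}] dx`
equals the stated closed form. -/
theorem rtd_outage_integral (σ T : ℝ) (hσ : σ ∈ Set.Ioo (0:ℝ) 1) (hT : 0 < T) :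
    ∫ x in (0:ℝ)..T,
        Real.exp (-x) *
          ((1 + ((1 - σ ^ 2) / σ ^ 2) * x) * Real.exp (-(((1 - σ ^ 2) / σ ^ 2) * x)) -
            (1 + ((1 - σ ^ 2) / σ ^ 2) * x +
                ((1 - σ ^ 2) / σ ^ 2) * x * (T - x) / σ ^ 2) *
              Real.exp (-(((1 - σ ^ 2) / σ ^ 2) * x) - (T - x) / σ ^ 2))
      = -(Real.exp (-(T / σ ^ 2)) / (6 * σ ^ 4)) *
          ((6 * σ ^ 8 - 12 * σ ^ 6) * Real.exp (T / σ ^ 2) + 12 * σ ^ 6 +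
            (3 * σ ^ 2 - 3 * σ ^ 4) * T ^ 2 + (12 * σ ^ 4 - 6 * σ ^ 6) * T +
            (1 - σ ^ 2) * T ^ 3 - 6 * σ ^ 8) := by
  have hσ0 : σ ≠ 0 := hσ.1.ne'
  have hintegrand : ∀ x : ℝ,
      Real.exp (-x) *
          ((1 + ((1 - σ ^ 2) / σ ^ 2) * x) * Real.exp (-(((1 - σ ^ 2) / σ ^ 2) * x)) -
            (1 + ((1 - σ ^ 2) / σ ^ 2) * x +
                ((1 - σ ^ 2) / σ ^ 2) * x * (T - x) / σ ^ 2) *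
              Real.exp (-(((1 - σ ^ 2) / σ ^ 2) * x) - (T - x) / σ ^ 2)) =
        (1 + ((1 - σ ^ 2) / σ ^ 2) * x) * Real.exp (-(1 / σ ^ 2 * x)) -
          (1 + ((1 - σ ^ 2) / σ ^ 2) * x +
            ((1 - σ ^ 2) / σ ^ 2) * (1 / σ ^ 2) * x * (T - x)) * Real.exp (-(T / σ ^ 2)) := by
    intro x
    have h₁ : -(1 / σ ^ 2 * x) = -x + -(((1 - σ ^ 2) / σ ^ 2) * x) := by
      field_simp
      ring
    have h₂ : -(T / σ ^ 2) = -x + (-(((1 - σ ^ 2) / σ ^ 2) * x) - (T - x) / σ ^ 2) := by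
      field_simp
      ring
    rw [h₁, h₂, Real.exp_add, Real.exp_add]
    ring
  simp only [hintegrand]
  rw [integral_one_add_mul_exp_sub _ _ _ _ (by positivity), one_div_mul_eq_div, Real.exp_neg]
  have hexp := Real.exp_ne_zero (T / σ ^ 2)
  generalize Real.exp (T / σ ^ 2) = E at hexp ⊢
  field_simp
  ring
end
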